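/- Let p > 1 and λ > 0 be real numbers. There is no function ψ : ℝ → ℝ that is differentiable on [0, ∞) and satisfies ψ(t) ≥ 0 for all t ≥ 0, ψ(0) > λ^(1/(p-1)), and ψ'(t) ≥ ψ(t)^p − λ·ψ(t) for all t ≥ 0. (Equivalently: any such differential inequality with supercritical initial value forces blow-up in finite time, so ψ cannot be defined on all of [0, ∞).) -/

import Mathlib

/-- Kaplan's ODE blow-up argument: no function `ψ` defined (and differentiable) on all of
`[0, ∞)` can be nonnegative, start above `λ^(1/(p-1))`, and satisfy
`ψ' ≥ ψ^p - λ ψ` on `[0, ∞)`. Here `ψ t ^ p` is the real power. -/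
theorem no_global_ode_solution (p lam : ℝ) (hp : 1 < p) (hlam : 0 < lam) :
    ¬ ∃ ψ : ℝ → ℝ,
      (∀ t : ℝ, 0 ≤ t → DifferentiableAt ℝ ψ t) ∧
      (∀ t : ℝ, 0 ≤ t → 0 ≤ ψ t) ∧
      lam ^ ((1 : ℝ) / (p - 1)) < ψ 0 ∧
      (∀ t : ℝ, 0 ≤ t → ψ t ^ p - lam * ψ t ≤ deriv ψ t) := by
  rintro ⟨ψ, hd, hn, h0, hi⟩
  have hp1 : 0 < p - 1 := by linarith
  have hexp : ∀ c t : ℝ, HasDerivAt (fun s => Real.exp (c * s)) (Real.exp (c * t) * c) t := by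
    intro c t
    have h : HasDerivAt (fun s : ℝ => c * s) c t := by
      simpa using (hasDerivAt_id t).const_mul c
    exact h.exp
  have hψ0 : 0 < ψ 0 := lt_trans (Real.rpow_pos_of_pos hlam _) h0
  have hpos : ∀ t : ℝ, 0 ≤ t → 0 < ψ t := by
    have hD : ∀ t : ℝ, 0 ≤ t → HasDerivAt (fun s => ψ s * Real.exp (lam * s))
        (deriv ψ t * Real.exp (lam * t) + ψ t * (Real.exp (lam * t) * lam)) t :=
      fun t ht => (hd t ht).hasDerivAt.mul (hexp lam t)
    have hm : MonotoneOn (fun s => ψ s * Real.exp (lam * s)) (Set.Ici 0) := by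
      apply monotoneOn_of_deriv_nonneg (convex_Ici 0)
      · exact fun t ht => (hD t ht).continuousAt.continuousWithinAt
      · intro t ht
        exact (hD t (interior_subset ht)).differentiableAt.differentiableWithinAt
      · intro t ht
        have ht' : 0 ≤ t := interior_subset ht
        rw [(hD t ht').deriv]
        have h1 := hi t ht'
        have h2 := Real.rpow_nonneg (hn t ht') p
        have h3 : 0 ≤ (deriv ψ t + lam * ψ t) * Real.exp (lam * t) :=
          mul_nonneg (by linarith) (Real.exp_pos _).le
        linarith
    intro t ht
    have h := hm (Set.mem_Ici.2 le_rfl) (Set.mem_Ici.2 ht) ht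
    simp only [mul_zero, Real.exp_zero, mul_one] at h
    exact pos_of_mul_pos_left (lt_of_lt_of_le hψ0 h) (Real.exp_pos _).le
  obtain ⟨c, hc⟩ : ∃ c, c = (p - 1) * lam := ⟨_, rfl⟩
  have hcpos : 0 < c := hc ▸ mul_pos hp1 hlam
  have hD : ∀ t : ℝ, 0 ≤ t → HasDerivAt
      (fun s => (ψ s ^ (1 - p) - 1 / lam) * Real.exp (-c * s))
      ((deriv ψ t * (1 - p) * ψ t ^ (1 - p - 1)) * Real.exp (-c * t)
        + (ψ t ^ (1 - p) - 1 / lam) * (Real.exp (-c * t) * -c)) t :=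
    fun t ht => (((hd t ht).hasDerivAt.rpow_const (Or.inl (hpos t ht).ne')).sub_const _).mul
      (hexp (-c) t)
  have hm : AntitoneOn (fun s => (ψ s ^ (1 - p) - 1 / lam) * Real.exp (-c * s)) (Set.Ici 0) := by
    apply antitoneOn_of_deriv_nonpos (convex_Ici 0)
    · exact fun t ht => (hD t ht).continuousAt.continuousWithinAt
    · intro t ht
      exact (hD t (interior_subset ht)).differentiableAt.differentiableWithinAt
    · intro t ht
      have ht' : 0 ≤ t := interior_subset ht
      rw [(hD t ht').deriv]
      have hp0 := hpos t ht'
      have e1 : ψ t ^ p * ψ t ^ (1 - p - 1) = 1 := by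
        rw [← Real.rpow_add hp0]; ring_nf; exact Real.rpow_zero _
      have e2 : ψ t * ψ t ^ (1 - p - 1) = ψ t ^ (1 - p) := by
        rw [mul_comm, ← Real.rpow_add_one hp0.ne']; ring_nf
      have h1 := mul_le_mul_of_nonneg_right (hi t ht') (Real.rpow_pos_of_pos hp0 (1 - p - 1)).le
      have h2 : 1 - lam * ψ t ^ (1 - p) ≤ deriv ψ t * ψ t ^ (1 - p - 1) := by
        rw [sub_mul, e1, mul_assoc, e2] at h1; exact h1
      have h3 := mul_le_mul_of_nonneg_left h2 hp1.le
      have h4 : (1 / lam) * c = p - 1 := by rw [hc]; field_simp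
      have h5 : (deriv ψ t * (1 - p) * ψ t ^ (1 - p - 1) 
          - (ψ t ^ (1 - p) - 1 / lam) * c) ≤ 0 := by
        rw [sub_mul, h4, hc]; linarith
      have h6 := mul_nonpos_of_nonpos_of_nonneg h5 (Real.exp_pos (-c * t)).le
      linarith
  obtain ⟨w, hw⟩ : ∃ w, w = ψ 0 ^ (1 - p) - 1 / lam := ⟨_, rfl⟩
  have hw0 : w < 0 := by
    have h1 : lam < ψ 0 ^ (p - 1) := by
      have h := Real.rpow_lt_rpow (Real.rpow_pos_of_pos hlam _).le h0 hp1
      rwa [← Real.rpow_mul hlam.le, one_div_mul_cancel hp1.ne', Real.rpow_one] at h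
    have h2 : ψ 0 ^ (1 - p) = 1 / ψ 0 ^ (p - 1) := by
      rw [← neg_sub, Real.rpow_neg hψ0.le, one_div]
    have h3 := one_div_lt_one_div_of_lt hlam h1
    rw [hw, h2]; linarith
  obtain ⟨T, hT⟩ : ∃ T, T = (1 / lam) / (-w) / c := ⟨_, rfl⟩
  have hT0 : 0 ≤ T := by
    have : 0 < -w := by linarith
    rw [hT]; positivity
  have h := hm (Set.mem_Ici.2 le_rfl) (Set.mem_Ici.2 hT0) hT0
  simp only [mul_zero, Real.exp_zero, mul_one] at h
  rw [← hw] at h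
  have h2 := mul_le_mul_of_nonneg_right h (Real.exp_pos (c * T)).le
  rw [mul_assoc, ← Real.exp_add, neg_mul, neg_add_cancel, Real.exp_zero, mul_one] at h2
  have h3 := mul_le_mul_of_nonpos_left (Real.add_one_le_exp (c * T)) hw0.le
  have h4 : w * (c * T) = - (1 / lam) := by
    have := hw0.ne
    rw [hT]; field_simp
  have h5 := Real.rpow_pos_of_pos (hpos T hT0) (1 - p)
  linarith
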